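/- arXiv:1706.02402 — 3 statements merged into one kernel-verified Lean document; each statement's English description precedes it below -/
import Mathlib

section
/- Let B be a standard one-dimensional Brownian motion with natural filtration (F_t). Suppose f : ℝ × [0,∞) → [0,∞) is a measurable function with f(0,0) = 1 such that the process t ↦ f(B_t, t) is a martingale with respect to (F_t). Then there exists a probability measure μ on ℝ such that for every t ≥ 0, almost surely f(B_t, t) = ∫_ℝ exp(λ B_t − (λ²/2) t) dμ(λ). -/
open MeasureTheory ProbabilityTheory

noncomputable section

/-- The natural filtration of a process `B`: `F t = σ(B s : 0 ≤ s ≤ t)`. -/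
def natFilt {Ω : Type*} (B : ℝ → Ω → ℝ) (t : ℝ) : MeasurableSpace Ω :=
  ⨆ s ∈ Set.Icc (0 : ℝ) t, MeasurableSpace.comap (B s) inferInstance

/-- `B` is a standard one-dimensional Brownian motion on `(Ω, P)`:
`B 0 = 0` a.s., each increment `B t - B s` (for `0 ≤ s ≤ t`) is independent of the past
and Gaussian `N(0, t - s)`, and almost every sample path is continuous on `[0, ∞)`. -/
structure IsStdBM {Ω : Type*} [MeasurableSpace Ω] (P : Measure Ω) (B : ℝ → Ω → ℝ) : Prop where
  isProb : IsProbabilityMeasure P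
  meas : ∀ t : ℝ, Measurable (B t)
  init : ∀ᵐ ω ∂P, B 0 ω = 0
  indep_incr : ∀ s t : ℝ, 0 ≤ s → s ≤ t →
    Indep (MeasurableSpace.comap (fun ω => B t ω - B s ω) inferInstance) (natFilt B s) P
  gauss_incr : ∀ s t : ℝ, 0 ≤ s → s ≤ t →
    P.map (fun ω => B t ω - B s ω) = gaussianReal 0 (Real.toNNReal (t - s))
  cont : ∀ᵐ ω ∂P, ContinuousOn (fun t => B t ω) (Set.Ici 0)

/-- `X` is a martingale with respect to the family of σ-algebras `F`, for times `t ≥ 0`. -/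
def IsMartingaleFrom0 {Ω : Type*} [MeasurableSpace Ω] (P : Measure Ω)
    (F : ℝ → MeasurableSpace Ω) (X : ℝ → Ω → ℝ) : Prop :=
  (∀ t : ℝ, 0 ≤ t → Integrable (X t) P) ∧
  (∀ t : ℝ, 0 ≤ t → Measurable[F t] (X t)) ∧
  (∀ s t : ℝ, 0 ≤ s → s ≤ t → P[X t | F s] =ᵐ[P] X s)

open scoped NNReal ENNReal

lemma tilt_gauss (s : ℝ) (hs : 0 < s) (l : ℝ) :
    (gaussianReal 0 s.toNNReal).withDensity (fun x => ENNReal.ofReal (Real.exp (l * x - l ^ 2 / 2 * s)))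
      = gaussianReal (s * l) s.toNNReal := by
  have hv : s.toNNReal ≠ 0 := by simpa using hs
  rw [gaussianReal_of_var_ne_zero _ hv, gaussianReal_of_var_ne_zero _ hv,
    ← withDensity_mul _ (measurable_gaussianPDF _ _) (by fun_prop)]
  congr 1
  ext x
  simp only [Pi.mul_apply, gaussianPDF, gaussianPDFReal]
  rw [← ENNReal.ofReal_mul (by positivity), mul_assoc, ← Real.exp_add, Real.coe_toNNReal _ hs.le]
  congr 3
  field_simp
  ring

lemma mixture_eq (s : ℝ) (hs : 0 < s) (μ : Measure ℝ) [IsProbabilityMeasure μ] :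
    (gaussianReal 0 s.toNNReal).withDensity
      (fun x => ∫⁻ l, ENNReal.ofReal (Real.exp (l * x - l ^ 2 / 2 * s)) ∂μ)
      = (μ.map (s * ·)) ∗ gaussianReal 0 s.toNNReal := by
  have hmeas : Measurable (fun p : ℝ × ℝ => ENNReal.ofReal (Real.exp (p.2 * p.1 - p.2 ^ 2 / 2 * s))) := by
    fun_prop
  ext A hA
  rw [withDensity_apply _ hA, ← lintegral_indicator_one hA, Measure.lintegral_conv (by
    exact measurable_one.indicator hA), lintegral_map (by
      apply Measurable.lintegral_prod_right' (f := fun p : ℝ × ℝ => A.indicator (1 : ℝ → ℝ≥0∞) (p.1 + p.2))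
      exact (measurable_one.indicator hA).comp (by fun_prop)) (by fun_prop)]
  rw [lintegral_lintegral_swap hmeas.aemeasurable]
  congr 1
  ext l
  rw [← withDensity_apply _ hA, tilt_gauss s hs l]
  have := gaussianReal_map_const_add (μ := 0) (v := s.toNNReal) (s * l)
  rw [zero_add] at this
  rw [← this, Measure.map_apply (by fun_prop) hA, ← lintegral_indicator_one (by measurability)]
  rfl

lemma levy_ex (μ : ℕ → Measure ℝ) [∀ n, IsProbabilityMeasure (μ n)] (g : ℝ → ℂ)
    (hg : ContinuousAt g 0)
    (h : ∀ t, Filter.Tendsto (fun n ↦ charFun (μ n) t) Filter.atTop (nhds (g t))) :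
    ∃ ν : Measure ℝ, IsProbabilityMeasure ν ∧ ∀ t, charFun ν t = g t := by
  have ht := isTightMeasureSet_of_tendsto_charFun hg h
  let m : ℕ → ProbabilityMeasure ℝ := fun n => ⟨μ n, inferInstance⟩
  have hc : IsCompact (closure (Set.range m)) := by
    apply isCompact_closure_of_isTightMeasureSet
    convert ht using 1
    ext x
    constructor
    · rintro ⟨_, ⟨n, rfl⟩, rfl⟩
      exact ⟨n, rfl⟩
    · rintro ⟨n, rfl⟩
      exact ⟨m n, ⟨n, rfl⟩, rfl⟩
  obtain ⟨ν, -, φ, hφ, hlim⟩ := hc.tendsto_subseq (x := m) (fun n => subset_closure ⟨n, rfl⟩)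
  refine ⟨ν, inferInstance, fun t => ?_⟩
  have h1 := ProbabilityMeasure.tendsto_iff_tendsto_charFun.1 hlim t
  exact tendsto_nhds_unique h1 ((h t).comp hφ.tendsto_atTop)

lemma bm_map {Ω : Type*} [MeasurableSpace Ω] {P : Measure Ω} {B : ℝ → Ω → ℝ} (hB : IsStdBM P B)
    (t : ℝ) (ht : 0 ≤ t) : P.map (B t) = gaussianReal 0 t.toNNReal := by
  have h := hB.gauss_incr 0 t le_rfl ht
  rw [sub_zero] at h
  rw [← h]
  apply Measure.map_congr
  filter_upwards [hB.init] with ω hω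
  simp [hω]

lemma bm_natFilt_meas {Ω : Type*} (B : ℝ → Ω → ℝ) (s : ℝ) (hs : 0 ≤ s) :
    Measurable[natFilt B s] (B s) := by
  apply Measurable.mono (comap_measurable (B s)) _ le_rfl
  exact le_iSup₂_of_le (f := fun s _ => MeasurableSpace.comap (B s) inferInstance) s ⟨hs, le_rfl⟩ le_rfl

lemma bm_natFilt_le {Ω : Type*} [m : MeasurableSpace Ω] {P : Measure Ω} {B : ℝ → Ω → ℝ}
    (hB : IsStdBM P B) (s : ℝ) : natFilt B s ≤ m :=
  iSup₂_le fun t _ => (hB.meas t).comap_le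

lemma bm_charFun {Ω : Type*} [MeasurableSpace Ω] {P : Measure Ω} {B : ℝ → Ω → ℝ}
    (hB : IsStdBM P B) (t : ℝ) (ht : 0 ≤ t) (u : ℝ) :
    ∫ ω, Complex.exp (u * B t ω * Complex.I) ∂P = Complex.exp (-(t * u ^ 2 / 2)) := by
  have h := charFun_gaussianReal (μ := 0) (v := t.toNNReal) u
  rw [← bm_map hB t ht, charFun_apply_real, integral_map (hB.meas t).aemeasurable (by fun_prop)] at h
  rw [h]
  simp [ht]

lemma bm_bridge_indep {Ω : Type*} [MeasurableSpace Ω] {P : Measure Ω} {B : ℝ → Ω → ℝ}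
    (hB : IsStdBM P B) (s t : ℝ) (hs : 0 < s) (hst : s ≤ t) :
    IndepFun (B t) (fun ω => B s ω - s / t * B t ω) P := by
  have := hB.isProb
  have ht : 0 < t := hs.trans_le hst
  have hX : HasGaussianLaw (B s) P := ⟨by rw [bm_map hB s hs.le]; infer_instance⟩
  have hT : HasGaussianLaw (B t) P := ⟨by rw [bm_map hB t ht.le]; infer_instance⟩
  have hD : HasGaussianLaw (fun ω => B t ω - B s ω) P :=
    ⟨by rw [hB.gauss_incr s t hs.le hst]; infer_instance⟩
  have hind : IndepFun (B s) (fun ω => B t ω - B s ω) P := by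
    rw [IndepFun_iff_Indep]
    exact indep_of_indep_of_le_left (hB.indep_incr s t hs.le hst).symm
      (bm_natFilt_meas B s hs.le).comap_le
  have hJ := hind.hasGaussianLaw hX hD
  apply HasGaussianLaw.indepFun_of_covariance_eq_zero
  · let L : ℝ × ℝ →L[ℝ] ℝ × ℝ :=
      (ContinuousLinearMap.fst ℝ ℝ ℝ + ContinuousLinearMap.snd ℝ ℝ ℝ).prod
       (ContinuousLinearMap.fst ℝ ℝ ℝ - (s / t) • (ContinuousLinearMap.fst ℝ ℝ ℝ + ContinuousLinearMap.snd ℝ ℝ ℝ))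
    have := hJ.map_fun L
    refine this.congr (.of_forall fun ω => ?_)
    simp [L]
    ring
  · have hvar : ∀ r, 0 ≤ r → Var[B r; P] = r := fun r hr => by
      have := variance_fun_id_gaussianReal (μ := 0) (v := r.toNNReal)
      rw [← bm_map hB r hr, variance_map (by fun_prop) (hB.meas r).aemeasurable] at this
      simpa [hr, Function.comp_def] using this
    have h1 : cov[B t, B s; P] = s := by
      have e : B t = B s + (fun ω => B t ω - B s ω) := by ext; simp
      rw [e, covariance_add_left hX.memLp_two hD.memLp_two hX.memLp_two,
        covariance_self (hB.meas s).aemeasurable, hvar s hs.le, covariance_comm,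
        hind.covariance_eq_zero hX.memLp_two hD.memLp_two, add_zero]
    have e : (fun ω => B s ω - s / t * B t ω) = B s - (fun ω => s / t * B t ω) := rfl
    rw [e, covariance_sub_right hT.memLp_two hX.memLp_two (hT.memLp_two.const_mul _), h1,
      covariance_const_mul_right, covariance_self (hB.meas t).aemeasurable, hvar t ht.le]
    field_simp
    simp

lemma bm_bridge {Ω : Type*} [MeasurableSpace Ω] {P : Measure Ω} {B : ℝ → Ω → ℝ}
    (hB : IsStdBM P B) (s t : ℝ) (hs : 0 < s) (hst : s ≤ t) (g : ℝ → ℝ) (hg : Measurable g) (u : ℝ) :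
    ∫ ω, (g (B t ω) : ℂ) * Complex.exp (u * B s ω * Complex.I) ∂P =
      (∫ ω, (g (B t ω) : ℂ) * Complex.exp (u * (s / t) * B t ω * Complex.I) ∂P) *
        Complex.exp (-(u ^ 2 * s * (1 - s / t) / 2)) := by
  have := hB.isProb
  have ht : 0 < t := hs.trans_le hst
  have hms := hB.meas s
  have hmt := hB.meas t
  have key : ∀ g : ℝ → ℝ, Measurable g →
    ∫ ω, (g (B t ω) : ℂ) * Complex.exp (u * B s ω * Complex.I) ∂P =
      (∫ ω, (g (B t ω) : ℂ) * Complex.exp (u * (s / t) * B t ω * Complex.I) ∂P) *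
        ∫ ω, Complex.exp (u * (B s ω - s / t * B t ω : ℝ) * Complex.I) ∂P := by
    intro g hg
    rw [← (bm_bridge_indep hB s t hs hst).integral_fun_comp_mul_comp
      (f := fun x => (g x : ℂ) * Complex.exp (u * (s / t) * x * Complex.I))
      (g := fun x : ℝ => Complex.exp (u * x * Complex.I)) (by fun_prop) (by fun_prop)
      (by fun_prop) (by fun_prop)]
    congr 1
    ext ω
    rw [mul_assoc (g (B t ω) : ℂ), ← Complex.exp_add]
    congr 2
    push_cast
    ring
  rw [key g hg]
  congr 1
  have h1 := key (fun _ => 1) (by fun_prop)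
  have h2 := bm_charFun hB t ht.le (u * (s / t))
  push_cast at h1 h2
  simp only [one_mul] at h1
  rw [bm_charFun hB s hs.le, h2] at h1
  have h3 : Complex.exp (-(s * u ^ 2 / 2)) = Complex.exp (-(t * (u * (s / t)) ^ 2 / 2)) *
      Complex.exp (-(u ^ 2 * s * (1 - s / t) / 2)) := by
    rw [← Complex.exp_add]
    congr 1
    have : (t : ℂ) ≠ 0 := by exact_mod_cast ht.ne'
    field_simp
    ring
  rw [h3] at h1
  push_cast
  exact (mul_left_cancel₀ (Complex.exp_ne_zero _) h1).symm

lemma mart_exp {Ω : Type*} [MeasurableSpace Ω] {P : Measure Ω} {B : ℝ → Ω → ℝ}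
    (hB : IsStdBM P B) (X : ℝ → Ω → ℝ) (hX : IsMartingaleFrom0 P (natFilt B) X)
    (s t : ℝ) (hs : 0 ≤ s) (hst : s ≤ t) (u : ℝ) :
    ∫ ω, (X t ω : ℂ) * Complex.exp (u * B s ω * Complex.I) ∂P =
      ∫ ω, (X s ω : ℂ) * Complex.exp (u * B s ω * Complex.I) ∂P := by
  have := hB.isProb
  have hms := hB.meas s
  have hm := bm_natFilt_le hB s
  have hi := hX.1 t (hs.trans hst)
  let e : Ω → ℂ := fun ω => Complex.exp (u * B s ω * Complex.I)
  have he : Measurable[natFilt B s] e := by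
    have : Measurable (fun x : ℝ => Complex.exp (u * x * Complex.I)) := by fun_prop
    exact this.comp (bm_natFilt_meas B s hs)
  have hint : Integrable (X t • e) P := by
    refine hi.mono (hi.aestronglyMeasurable.smul (he.mono hm le_rfl).aestronglyMeasurable)
      (.of_forall fun ω => ?_)
    simp only [e, Pi.smul_apply', norm_smul]
    rw [← Complex.ofReal_mul, Complex.norm_exp_ofReal_mul_I, mul_one]
  have h := condExp_smul_of_aestronglyMeasurable_right (m := natFilt B s) hi hint
    he.stronglyMeasurable.aestronglyMeasurable
  have h2 := integral_condExp hm (f := X t • e) (μ := P)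
  have h3 : ∫ ω, (X t • e) ω ∂P = ∫ ω, (X s • e) ω ∂P := by
    rw [← h2]
    apply integral_congr_ae
    filter_upwards [h, hX.2.2 s t hs hst] with ω h1 h2
    rw [h1, Pi.smul_apply', h2, Pi.smul_apply']
  simpa [e] using h3

/-- Every nonnegative measurable space-time harmonic function of Brownian motion with
`f 0 0 = 1` is a mixture of exponential martingales: there is a probability measure `μ` on `ℝ`
with `f (B t) t = ∫ exp (λ B t - λ²/2 t) dμ(λ)` a.s. for every `t ≥ 0`. -/
theorem spaceTimeHarmonic_representation {Ω : Type*} [MeasurableSpace Ω]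
    (P : Measure Ω) (B : ℝ → Ω → ℝ) (hB : IsStdBM P B)
    (f : ℝ → ℝ → ℝ) (hf_meas : Measurable (Function.uncurry f))
    (hf_nonneg : ∀ x t : ℝ, 0 ≤ t → 0 ≤ f x t)
    (hf_one : f 0 0 = 1)
    (hmart : IsMartingaleFrom0 P (natFilt B) (fun t ω => f (B t ω) t)) :
    ∃ μ : Measure ℝ, IsProbabilityMeasure μ ∧
      ∀ t : ℝ, 0 ≤ t → ∀ᵐ ω ∂P,
        f (B t ω) t = ∫ l : ℝ, Real.exp (l * B t ω - l ^ 2 / 2 * t) ∂μ := by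
  have := hB.isProb
  have hmf : ∀ t, Measurable (fun x => f x t) := fun t => hf_meas.comp (measurable_id.prodMk measurable_const)
  have h0 : ∀ᵐ ω ∂P, f (B 0 ω) 0 = 1 := by
    filter_upwards [hB.init] with ω hω
    rw [hω, hf_one]
  let ρ : ℝ → Measure ℝ := fun t =>
    (gaussianReal 0 t.toNNReal).withDensity (fun x => ENNReal.ofReal (f x t))
  have hmass : ∀ t, 0 ≤ t → ∫ ω, f (B t ω) t ∂P = 1 := by
    intro t ht
    rw [← integral_condExp (bm_natFilt_le hB 0), integral_congr_ae (hmart.2.2 0 t le_rfl ht),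
      integral_congr_ae h0]
    simp
  have hρp : ∀ t, 0 ≤ t → IsProbabilityMeasure (ρ t) := by
    intro t ht
    refine ⟨?_⟩
    simp only [ρ]
    rw [withDensity_apply _ MeasurableSet.univ, Measure.restrict_univ, ← bm_map hB t ht,
      lintegral_map (hmf t).ennreal_ofReal (hB.meas t),
      ← ofReal_integral_eq_lintegral_ofReal (hmart.1 t ht) (.of_forall fun ω => hf_nonneg _ _ ht),
      hmass t ht, ENNReal.ofReal_one]
  have hρc : ∀ t, 0 ≤ t → ∀ u : ℝ, charFun (ρ t) u =
      ∫ ω, (f (B t ω) t : ℂ) * Complex.exp (u * B t ω * Complex.I) ∂P := by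
    intro t ht u
    have hm2 := hmf t
    rw [charFun_apply_real]
    simp only [ρ]
    rw [integral_withDensity_eq_integral_toReal_smul (hmf t).ennreal_ofReal
      (.of_forall fun _ => ENNReal.ofReal_lt_top), ← bm_map hB t ht,
      integral_map (hB.meas t).aemeasurable (by
        apply Measurable.aestronglyMeasurable
        fun_prop)]
    congr 1
    ext ω
    rw [ENNReal.toReal_ofReal (hf_nonneg _ _ ht), Complex.real_smul]
  have hR : ∀ s t, 0 < s → s ≤ t → ∀ u : ℝ, charFun (ρ s) u =
      charFun (ρ t) (u * (s / t)) * Complex.exp (-(u ^ 2 * s * (1 - s / t) / 2)) := by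
    intro s t hs hst u
    rw [hρc s hs.le, hρc t (hs.le.trans hst), ← mart_exp hB _ hmart s t hs.le hst u,
      bm_bridge hB s t hs hst (fun x => f x t) (hmf t) u]
    push_cast
    rfl
  let μ : ℕ → Measure ℝ := fun n => (ρ ((n : ℝ) + 1)).map (((n : ℝ) + 1)⁻¹ * ·)
  have hμp : ∀ n, IsProbabilityMeasure (μ n) := by
    intro n
    have := hρp ((n : ℝ) + 1) (by positivity)
    exact Measure.isProbabilityMeasure_map (by fun_prop)
  have hp1 := hρp 1 zero_le_one
  obtain ⟨ν, hν, hνc⟩ := levy_ex μ (fun v => charFun (ρ 1) v * Complex.exp (v ^ 2 / 2))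
    (by
      have := continuous_charFun (μ := ρ 1)
      fun_prop) (by
      intro v
      have e : ∀ n, charFun (μ n) v =
          charFun (ρ 1) v * Complex.exp (v ^ 2 * (1 - ((1 / ((n : ℝ) + 1) : ℝ) : ℂ)) / 2) := by
        intro n
        simp only [μ]
        have hn : (1 : ℝ) ≤ (n : ℝ) + 1 := by simp
        rw [charFun_map_mul, hR 1 ((n : ℝ) + 1) one_pos hn v, mul_assoc, ← Complex.exp_add]
        rw [one_div, mul_comm]
        push_cast
        rw [one_div]
        simp only [mul_one]
        rw [neg_add_cancel, Complex.exp_zero, mul_one]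
      simp_rw [e]
      apply Filter.Tendsto.const_mul
      have hc : Continuous (fun x : ℝ => Complex.exp (v ^ 2 * (1 - (x : ℂ)) / 2)) := by fun_prop
      have := (hc.tendsto 0).comp (tendsto_one_div_add_atTop_nhds_zero_nat (𝕜 := ℝ))
      simpa [Function.comp_def] using this)
  refine ⟨ν, hν, fun t ht => ?_⟩
  rcases ht.eq_or_lt with rfl | ht0
  · filter_upwards [h0, hB.init] with ω hω hω'
    rw [hω]
    simp [hω']
  have hconv : ρ t = (ν.map (t * ·)) ∗ gaussianReal 0 t.toNNReal := by
    have := hρp t ht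
    have : IsProbabilityMeasure (ν.map (t * ·)) := Measure.isProbabilityMeasure_map (by fun_prop)
    apply Measure.ext_of_charFun
    ext u
    rw [charFun_conv, charFun_map_mul, hνc, charFun_gaussianReal]
    have hT0 : (0 : ℝ) < max t 1 := lt_max_of_lt_right one_pos
    rw [hR t (max t 1) ht0 (le_max_left _ _) u, hR 1 (max t 1) one_pos (le_max_right _ _)]
    have hTc : ((max t 1 : ℝ) : ℂ) ≠ 0 := by exact_mod_cast hT0.ne'
    rw [show t * u * (1 / max t 1) = u * (t / max t 1) by ring,
      mul_assoc (charFun (ρ (max t 1)) (u * (t / max t 1))), mul_assoc (charFun (ρ (max t 1)) (u * (t / max t 1))),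
      ← Complex.exp_add, ← Complex.exp_add]
    congr 2
    rw [Real.coe_toNNReal _ ht]
    generalize ((max t 1 : ℝ) : ℂ) = T at *
    push_cast
    field_simp
    ring
  rw [← mixture_eq t ht0 ν] at hconv
  have hgm : Measurable (fun x => ∫⁻ l, ENNReal.ofReal (Real.exp (l * x - l ^ 2 / 2 * t)) ∂ν) := by
    apply Measurable.lintegral_prod_right'
      (f := fun p : ℝ × ℝ => ENNReal.ofReal (Real.exp (p.2 * p.1 - p.2 ^ 2 / 2 * t)))
    fun_prop
  have hae := (withDensity_eq_iff_of_sigmaFinite (hmf t).ennreal_ofReal.aemeasurable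
    hgm.aemeasurable).1 hconv
  rw [← bm_map hB t ht] at hae
  filter_upwards [ae_of_ae_map (hB.meas t).aemeasurable hae] with ω hω
  rw [integral_eq_lintegral_of_nonneg_ae (.of_forall fun _ => (Real.exp_pos _).le) (by fun_prop),
    ← hω, ENNReal.toReal_ofReal (hf_nonneg _ _ ht)]
end
end

section
/- Let ρ > 0, κ > 0, and c₁ > 0, and suppose f : (0,∞) → [0,∞) is a nonnegative, locally integrable function satisfying f(t) ≤ c₁ + κ ∫₀ᵗ (t − s)^{ρ−1} f(s) ds for all t > 0. Then there exist positive constants c₂ and c₃ such that f(t) ≤ c₂ exp(c₃ (Γ(ρ))^{1/ρ} κ^{1/ρ} t) for all t > 0, where Γ denotes the Gamma function. -/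
open MeasureTheory

noncomputable def rK (ρ κ l : ℝ) (u : ℝ) : ENNReal :=
  (Set.Ioi (0:ℝ)).indicator (fun u => ENNReal.ofReal (κ * (u ^ (ρ - 1) * Real.exp (-(l * u))))) u

lemma rK_meas (ρ κ l : ℝ) : Measurable (rK ρ κ l) := by
  unfold rK
  refine Measurable.indicator ?_ measurableSet_Ioi
  fun_prop

lemma rK_int (ρ κ l : ℝ) (hρ : 0 < ρ) (hκ : 0 < κ) (hl : 0 < l)
    (h : κ * (l ^ (-ρ) * Real.Gamma ρ) = 1 / 2) :
    ∫⁻ u, rK ρ κ l u = ENNReal.ofReal (1/2) := by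
  unfold rK
  rw [lintegral_indicator measurableSet_Ioi, ← ofReal_integral_eq_lintegral_ofReal]
  · rw [integral_const_mul, Real.integral_rpow_mul_exp_neg_mul_Ioi hρ hl, ← h]
    congr 2
    rw [one_div, Real.inv_rpow hl.le, Real.rpow_neg hl.le]
  · have := integrableOn_rpow_mul_exp_neg_mul_rpow (p := 1) (s := ρ - 1) (b := l)
      (by linarith) (by norm_num) hl
    refine Integrable.const_mul ?_ κ
    simpa [IntegrableOn] using this
  · filter_upwards [ae_restrict_mem measurableSet_Ioi] with u hu
    have : (0:ℝ) < u := hu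
    simp only [Pi.zero_apply]
    positivity

lemma step1 (ρ κ c₁ l : ℝ) (hρ : 0 < ρ) (hκ : 0 < κ) (hc₁ : 0 < c₁) (hl : 0 < l)
    (h : κ * (l ^ (-ρ) * Real.Gamma ρ) = 1 / 2)
    (f : ℝ → ℝ) (hf_nonneg : ∀ t : ℝ, 0 < t → 0 ≤ f t)
    (hf_ineq : ∀ t : ℝ, 0 < t →
      f t ≤ c₁ + κ * ∫ s in Set.Ioc (0 : ℝ) t, (t - s) ^ (ρ - 1) * f s)
    (t : ℝ) (ht : 0 < t) :
    ENNReal.ofReal (Real.exp (-(l * t)) * f t - 2 * c₁) ≤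
      ∫⁻ s in Set.Ioo 0 t, rK ρ κ l (t - s) *
        ENNReal.ofReal (Real.exp (-(l * s)) * f s - 2 * c₁) := by
  rw [ENNReal.ofReal_sub _ (by positivity), tsub_le_iff_right]
  have e1 : Real.exp (-(l * t)) * f t ≤ c₁ + ∫ s in Set.Ioo (0 : ℝ) t,
      κ * ((t - s) ^ (ρ - 1) * Real.exp (-(l * (t - s)))) * (Real.exp (-(l * s)) * f s) := by
    have h1 := mul_le_mul_of_nonneg_left (hf_ineq t ht) (Real.exp_pos (-(l * t))).le
    have h2 : Real.exp (-(l * t)) ≤ 1 := Real.exp_le_one_iff.2 (by nlinarith)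
    refine h1.trans ?_
    rw [mul_add, ← integral_Ioc_eq_integral_Ioo, ← mul_assoc, ← integral_const_mul]
    refine add_le_add (by nlinarith) (le_of_eq ?_)
    congr 1
    ext s
    have : Real.exp (-(l * t)) = Real.exp (-(l * (t - s))) * Real.exp (-(l * s)) := by
      rw [← Real.exp_add]; congr 1; ring
    rw [this]; ring
  refine (ENNReal.ofReal_le_ofReal e1).trans ?_
  refine ENNReal.ofReal_add_le.trans ?_
  have e2 : ENNReal.ofReal (∫ s in Set.Ioo (0 : ℝ) t,
      κ * ((t - s) ^ (ρ - 1) * Real.exp (-(l * (t - s)))) * (Real.exp (-(l * s)) * f s)) ≤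
      ∫⁻ s in Set.Ioo 0 t, (rK ρ κ l (t - s) * ENNReal.ofReal (2 * c₁) + rK ρ κ l (t - s) *
        ENNReal.ofReal (Real.exp (-(l * s)) * f s - 2 * c₁)) := by
    refine (Real.ofReal_le_enorm _).trans ((enorm_integral_le_lintegral_enorm _).trans ?_)
    refine setLIntegral_mono' measurableSet_Ioo ?_
    intro s hs
    have hts : 0 < t - s := sub_pos.2 hs.2
    have hfs := hf_nonneg s hs.1
    rw [← mul_add, ← ofReal_norm, Real.norm_of_nonneg (by positivity),
      ENNReal.ofReal_mul (by positivity)]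
    unfold rK
    rw [Set.indicator_of_mem (show t - s ∈ Set.Ioi 0 from hts)]
    gcongr
    refine le_trans (le_of_eq ?_) ENNReal.ofReal_add_le
    congr 1; ring
  rw [lintegral_add_left (by have := rK_meas ρ κ l; fun_prop)] at e2
  rw [lintegral_mul_const _ (by have := rK_meas ρ κ l; fun_prop)] at e2
  have e3 : ∫⁻ s in Set.Ioo 0 t, rK ρ κ l (t - s) ≤ ENNReal.ofReal (1/2) := by
    rw [← rK_int ρ κ l hρ hκ hl h, ← lintegral_sub_left_eq_self (rK ρ κ l) t]
    exact setLIntegral_le_lintegral _ _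
  calc _ ≤ ENNReal.ofReal c₁ + (ENNReal.ofReal (1/2) * ENNReal.ofReal (2 * c₁) + _) := by
        gcongr; exact e2.trans (by gcongr)
    _ = _ := by
        rw [← ENNReal.ofReal_mul (by norm_num), ← add_assoc,
          ← ENNReal.ofReal_add (by positivity) (by positivity), add_comm]
        congr 2; ring

lemma step2 (ρ κ c₁ l : ℝ) (hρ : 0 < ρ) (hκ : 0 < κ) (hc₁ : 0 < c₁) (hl : 0 < l)
    (h : κ * (l ^ (-ρ) * Real.Gamma ρ) = 1 / 2)
    (f : ℝ → ℝ) (hf_nonneg : ∀ t : ℝ, 0 < t → 0 ≤ f t)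
    (hf_ineq : ∀ t : ℝ, 0 < t →
      f t ≤ c₁ + κ * ∫ s in Set.Ioc (0 : ℝ) t, (t - s) ^ (ρ - 1) * f s)
    (T : ℝ) (hT : 0 < T) (hint : IntegrableOn f (Set.Ioc 0 T)) :
    f T ≤ 2 * c₁ * Real.exp (l * T) := by
  set H : ℝ → ENNReal := (Set.Ioc 0 T).indicator
    (fun s => ENNReal.ofReal (Real.exp (-(l * s)) * f s - 2 * c₁)) with hH
  have hHm : AEMeasurable H := by
    rw [hH, aemeasurable_indicator_iff measurableSet_Ioc]
    have := hint.aestronglyMeasurable.aemeasurable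
    fun_prop
  have hk := rK_meas ρ κ l
  have hHle : ∀ t, H t ≤ ∫⁻ s, rK ρ κ l (t - s) * H s := by
    intro t
    by_cases ht : t ∈ Set.Ioc 0 T
    · rw [hH, Set.indicator_of_mem ht]
      refine (step1 ρ κ c₁ l hρ hκ hc₁ hl h f hf_nonneg hf_ineq t ht.1).trans ?_
      refine le_trans ?_ (setLIntegral_le_lintegral (Set.Ioo 0 t) _)
      refine setLIntegral_mono' measurableSet_Ioo ?_
      intro s hs
      rw [Set.indicator_of_mem (show s ∈ Set.Ioc 0 T from ⟨hs.1, hs.2.le.trans ht.2⟩)]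
    · rw [hH, Set.indicator_of_notMem ht]; simp
  have hfin : ∫⁻ s, H s ≠ ⊤ := by
    rw [hH, lintegral_indicator measurableSet_Ioc]
    refine ne_top_of_le_ne_top hint.2.ne ?_
    refine setLIntegral_mono' measurableSet_Ioc ?_
    intro s hs
    refine le_trans (ENNReal.ofReal_le_ofReal ?_) (Real.ofReal_le_enorm _)
    have h2 : Real.exp (-(l * s)) ≤ 1 := Real.exp_le_one_iff.2 (by nlinarith [hs.1])
    nlinarith [hf_nonneg s hs.1]
  have hle : ∫⁻ s, H s ≤ ENNReal.ofReal (1/2) * ∫⁻ s, H s := by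
    calc _ ≤ ∫⁻ t, ∫⁻ s, rK ρ κ l (t - s) * H s := lintegral_mono hHle
      _ = ∫⁻ s, ∫⁻ t, rK ρ κ l (t - s) * H s := by
        refine lintegral_lintegral_swap ?_
        refine AEMeasurable.mul ?_ ?_
        · exact (hk.comp (measurable_fst.sub measurable_snd)).aemeasurable
        · exact hHm.comp_quasiMeasurePreserving Measure.quasiMeasurePreserving_snd
      _ = ∫⁻ s, ENNReal.ofReal (1/2) * H s := by
        congr 1; ext s
        rw [lintegral_mul_const _ (by fun_prop), lintegral_sub_right_eq_self (rK ρ κ l) s,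
          rK_int ρ κ l hρ hκ hl h]
      _ = _ := lintegral_const_mul' _ _ ENNReal.ofReal_ne_top
  have hz : ∫⁻ s, H s = 0 := by
    lift (∫⁻ s, H s) to NNReal using hfin with a
    have h3 := ENNReal.toReal_mono (by finiteness) hle
    rw [ENNReal.toReal_mul, ENNReal.toReal_ofReal (by norm_num), ENNReal.coe_toReal] at h3
    have h4 : (a:ℝ) = 0 := by linarith [a.2, show (0:ℝ) ≤ a from a.2]
    simpa using h4
  rw [lintegral_eq_zero_iff' hHm] at hz
  have h5 : H T ≤ 0 := by
    refine (hHle T).trans (le_of_eq ?_)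
    rw [← lintegral_zero (μ := (volume : Measure ℝ))]
    refine lintegral_congr_ae ?_
    filter_upwards [hz] with s hs
    simp [hs]
  rw [hH, Set.indicator_of_mem (show T ∈ Set.Ioc 0 T from ⟨hT, le_rfl⟩), nonpos_iff_eq_zero, ENNReal.ofReal_eq_zero] at h5
  rw [Real.exp_neg] at h5
  have := Real.exp_pos (l * T)
  rw [sub_nonpos, inv_mul_le_iff₀ this] at h5
  linarith

lemma step3 (ρ : ℝ) (f : ℝ → ℝ) (hf_loc : LocallyIntegrableOn f (Set.Ioi 0))
    (t : ℝ) (ht : 0 < t)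
    (hi : IntegrableOn (fun s => (t - s) ^ (ρ - 1) * f s) (Set.Ioc 0 t)) (T : ℝ) :
    IntegrableOn f (Set.Ioc 0 T) := by
  have h1 : IntegrableOn f (Set.Ioc 0 (t/2)) := by
    have h2 := hi.mono_set (Set.Ioc_subset_Ioc_right (by linarith : t/2 ≤ t))
    have hc : ContinuousOn (fun s : ℝ => (t - s) ^ (1 - ρ)) (Set.Icc 0 (t/2)) := by
      refine ContinuousOn.rpow_const (by fun_prop) ?_
      intro s hs
      left
      have := hs.2
      intro h; linarith
    have h2' := (integrableOn_Icc_iff_integrableOn_Ioc).2 h2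
    have h3 := h2'.continuousOn_mul hc isCompact_Icc
    rw [← integrableOn_Icc_iff_integrableOn_Ioc]
    refine h3.congr_fun ?_ measurableSet_Icc
    intro s hs
    have : 0 < t - s := by linarith [hs.2]
    simp only []
    rw [← mul_assoc, ← Real.rpow_add this]
    simp
  have h4 : IntegrableOn f (Set.Icc (t/2) T) :=
    hf_loc.integrableOn_compact_subset (fun s hs => lt_of_lt_of_le (by linarith) hs.1)
      isCompact_Icc
  refine (h1.union h4).mono_set ?_
  intro s hs
  rcases le_total s (t/2) with h | h
  · exact Or.inl ⟨hs.1, h⟩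
  · exact Or.inr ⟨h, hs.2⟩

/-- A Gronwall-type renewal inequality: if a nonnegative locally integrable `f` satisfies
`f t ≤ c₁ + κ ∫₀ᵗ (t - s)^(ρ - 1) f s ds` for all `t > 0`, then
`f t ≤ c₂ exp (c₃ Γ(ρ)^(1/ρ) κ^(1/ρ) t)` for all `t > 0`, for some constants `c₂, c₃ > 0`. -/
theorem renewal_inequality_exponential_bound
    (ρ κ c₁ : ℝ) (hρ : 0 < ρ) (hκ : 0 < κ) (hc₁ : 0 < c₁)
    (f : ℝ → ℝ) (hf_nonneg : ∀ t : ℝ, 0 < t → 0 ≤ f t)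
    (hf_loc : LocallyIntegrableOn f (Set.Ioi 0))
    (hf_ineq : ∀ t : ℝ, 0 < t →
      f t ≤ c₁ + κ * ∫ s in Set.Ioc (0 : ℝ) t, (t - s) ^ (ρ - 1) * f s) :
    ∃ c₂ c₃ : ℝ, 0 < c₂ ∧ 0 < c₃ ∧ ∀ t : ℝ, 0 < t →
      f t ≤ c₂ * Real.exp (c₃ * Real.Gamma ρ ^ (1 / ρ) * κ ^ (1 / ρ) * t) := by
  have hG := Real.Gamma_pos_of_pos hρ
  refine ⟨2 * c₁, 2 ^ (1 / ρ), by positivity, by positivity, ?_⟩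
  set l := (2:ℝ) ^ (1 / ρ) * Real.Gamma ρ ^ (1 / ρ) * κ ^ (1 / ρ) with hl
  have hlpos : 0 < l := by positivity
  have h : κ * (l ^ (-ρ) * Real.Gamma ρ) = 1 / 2 := by
    have : l ^ ρ = 2 * Real.Gamma ρ * κ := by
      rw [hl, ← Real.mul_rpow (by positivity) (by positivity),
        ← Real.mul_rpow (by positivity) (by positivity), ← Real.rpow_mul (by positivity),
        one_div_mul_cancel hρ.ne', Real.rpow_one]
    rw [Real.rpow_neg hlpos.le, this]
    field_simp
  intro t ht
  by_cases hex : ∃ t : ℝ, 0 < t ∧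
      IntegrableOn (fun s => (t - s) ^ (ρ - 1) * f s) (Set.Ioc 0 t)
  · obtain ⟨t₀, ht₀, hi⟩ := hex
    exact step2 ρ κ c₁ l hρ hκ hc₁ hlpos h f hf_nonneg hf_ineq t ht
      (step3 ρ f hf_loc t₀ ht₀ hi t)
  · push Not at hex
    have h1 := hf_ineq t ht
    rw [integral_undef (hex t ht)] at h1
    have : 1 ≤ Real.exp (l * t) := Real.one_le_exp (by positivity)
    nlinarith
end

section
/- Let B be a standard one-dimensional Brownian motion with natural filtration (F_t), and for n ∈ ℕ define H_n(x, t) := t^{n/2} h_n(x/√t) for t > 0 and H_n(x, 0) := xⁿ, where h_n are the probabilists' Hermite polynomials. Then for every n, the process t ↦ H_n(B_t, t) is a martingale with respect to (F_t). -/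
open MeasureTheory ProbabilityTheory

noncomputable section

/-- The space-time Hermite functions `H_n(x, t) = t^(n/2) h_n(x/√t)` for `t > 0`,
with `H_n(x, 0) = xⁿ`, where `h_n` is the `n`-th probabilists' Hermite polynomial. -/
def hermiteSpaceTime (n : ℕ) (x t : ℝ) : ℝ :=
  if t = 0 then x ^ n
  else t ^ ((n : ℝ) / 2) * Polynomial.aeval (x / Real.sqrt t) (Polynomial.hermite n)

/-- Normalised space-time Hermite polynomials. -/
def gH : ℕ → ℝ → ℝ → ℝ
  | 0, _, _ => 1
  | 1, x, _ => x
  | (n+2), x, t => (x * gH (n+1) x t - t * gH n x t) / (n + 2)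

theorem gH_rec (n : ℕ) (x t : ℝ) :
    ((n : ℝ) + 2) * gH (n+2) x t = x * gH (n+1) x t - t * gH n x t := by
  rw [gH]; field_simp

theorem deriv_hermite_succ (n : ℕ) :
    Polynomial.derivative (Polynomial.hermite (n+1)) = ((n : Polynomial ℤ) + 1) * Polynomial.hermite n := by
  induction n with
  | zero => simp
  | succ k ih =>
    rw [Polynomial.hermite_succ (k+1)]
    simp only [Polynomial.derivative_sub, Polynomial.derivative_mul, Polynomial.derivative_X, ih]
    have h2 : Polynomial.derivative (((k : Polynomial ℤ) + 1)) = 0 := by simp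
    rw [h2, Polynomial.hermite_succ k]
    push_cast
    ring

theorem hermite_three (n : ℕ) (x : ℝ) :
    Polynomial.aeval x (Polynomial.hermite (n+2)) =
      x * Polynomial.aeval x (Polynomial.hermite (n+1))
        - ((n : ℝ) + 1) * Polynomial.aeval x (Polynomial.hermite n) := by
  rw [Polynomial.hermite_succ (n+1), deriv_hermite_succ]
  simp

theorem hst_eq (n : ℕ) (x t : ℝ) (ht : 0 ≤ t) :
    hermiteSpaceTime n x t = (n.factorial : ℝ) * gH n x t := by
  unfold hermiteSpaceTime
  split_ifs with h
  · subst h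
    induction n using Nat.twoStepInduction with
    | zero => simp [gH]
    | one => simp [gH]
    | more n _ ih =>
      have := gH_rec n x 0
      rw [Nat.factorial_succ]
      push_cast
      have e : (n : ℝ) + 1 + 1 = n + 2 := by ring
      rw [e, mul_right_comm, this, pow_succ, ih]; ring
  · have hpos : 0 < t := lt_of_le_of_ne ht (Ne.symm h)
    have hs : 0 < √t := Real.sqrt_pos.2 hpos
    have hss : √t * √t = t := Real.mul_self_sqrt ht
    have e : t ^ ((n : ℝ) / 2) = √t ^ n := by
      rw [Real.sqrt_eq_rpow, ← Real.rpow_natCast, ← Real.rpow_mul ht]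
      congr 1; ring
    rw [e]
    clear e
    generalize √t = r at *
    induction n using Nat.twoStepInduction with
    | zero => simp [gH]
    | one => simp [gH]; field_simp
    | more n ih0 ih =>
      have := gH_rec n x t
      rw [hermite_three, Nat.factorial_succ]
      push_cast
      have e : (n : ℝ) + 1 + 1 = n + 2 := by ring
      rw [e, mul_right_comm, this]
      have e1 : r ^ (n+2) * (x / r * Polynomial.aeval (x / r) (Polynomial.hermite (n+1))
        - ((n : ℝ) + 1) * Polynomial.aeval (x / r) (Polynomial.hermite n))
        = x * (r ^ (n+1) * Polynomial.aeval (x / r) (Polynomial.hermite (n+1)))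
          - (r * r) * (n + 1) * (r ^ n * Polynomial.aeval (x / r) (Polynomial.hermite n)) := by
        field_simp
        ring
      rw [e1, ih, ih0, hss, Nat.factorial_succ]
      push_cast
      ring

/-- generating series -/
def gS (x t : ℝ) : PowerSeries ℝ := PowerSeries.mk (fun n => gH n x t)

theorem gS_deriv (x t : ℝ) :
    PowerSeries.derivative ℝ (gS x t) = (PowerSeries.C x - PowerSeries.C t * PowerSeries.X) * gS x t := by
  ext n
  cases n with
  | zero =>
    simp [gS, PowerSeries.coeff_derivative, sub_mul, mul_assoc, gH]
  | succ n =>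
    have := gH_rec n x t
    simp only [gS, PowerSeries.coeff_derivative, sub_mul, mul_assoc, map_sub,
      PowerSeries.coeff_C_mul, PowerSeries.coeff_mk, PowerSeries.coeff_succ_X_mul]
    push_cast
    linarith

theorem series_unique (a b : ℝ) (F G : PowerSeries ℝ)
    (hF : PowerSeries.derivative ℝ F = (PowerSeries.C a - PowerSeries.C b * PowerSeries.X) * F)
    (hG : PowerSeries.derivative ℝ G = (PowerSeries.C a - PowerSeries.C b * PowerSeries.X) * G)
    (h0 : PowerSeries.coeff 0 F = PowerSeries.coeff 0 G) : F = G := by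
  have key : ∀ n, PowerSeries.coeff n F = PowerSeries.coeff n G := by
    intro n
    induction n using Nat.twoStepInduction with
    | zero => exact h0
    | one =>
      have h1 := congrArg (PowerSeries.coeff 0) hF
      have h2 := congrArg (PowerSeries.coeff 0) hG
      simp [PowerSeries.coeff_derivative, sub_mul, mul_assoc] at h1 h2 h0
      rw [h1, h2, h0]
    | more n i0 i1 =>
      have h1 := congrArg (PowerSeries.coeff (n+1)) hF
      have h2 := congrArg (PowerSeries.coeff (n+1)) hG
      simp only [PowerSeries.coeff_derivative, sub_mul, mul_assoc, map_sub,
        PowerSeries.coeff_C_mul, PowerSeries.coeff_succ_X_mul] at h1 h2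
      rw [i0, i1, ← h2] at h1
      refine mul_right_cancel₀ ?_ h1
      positivity
  ext n; exact key n

theorem gH_add (n : ℕ) (x y s u : ℝ) :
    gH n (x + y) (s + u) = ∑ p ∈ Finset.HasAntidiagonal.antidiagonal n, gH p.1 x s * gH p.2 y u := by
  have : gS (x+y) (s+u) = gS x s * gS y u := by
    apply series_unique (x+y) (s+u) _ _ (gS_deriv _ _)
    · rw [Derivation.leibniz, gS_deriv, gS_deriv]
      simp only [smul_eq_mul, map_add]
      ring
    · simp [gS, gH]
  have h := congrArg (PowerSeries.coeff n) this
  simpa [gS, PowerSeries.coeff_mul] using h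

theorem gH_poly (n : ℕ) (t : ℝ) : ∃ p : Polynomial ℝ, ∀ x, gH n x t = p.eval x := by
  induction n using Nat.twoStepInduction with
  | zero => exact ⟨1, by simp [gH]⟩
  | one => exact ⟨Polynomial.X, by simp [gH]⟩
  | more n i0 i1 =>
    obtain ⟨p, hp⟩ := i0
    obtain ⟨q, hq⟩ := i1
    refine ⟨(Polynomial.X * q - Polynomial.C t * p) * Polynomial.C ((n+2 : ℝ)⁻¹), fun x => ?_⟩
    simp [gH, hp, hq, div_eq_mul_inv]

theorem gH_cont (n : ℕ) (t : ℝ) : Continuous fun x => gH n x t := by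
  obtain ⟨p, hp⟩ := gH_poly n t
  simp only [hp]; exact p.continuous

theorem gH_int (n : ℕ) (t : ℝ) (v : NNReal) : Integrable (fun x => gH n x t) (gaussianReal 0 v) := by
  obtain ⟨p, hp⟩ := gH_poly n t
  simp only [hp, Polynomial.eval_eq_sum, Polynomial.sum]
  refine integrable_finsetSum _ fun k _ => Integrable.const_mul ?_ _
  have := (memLp_id_gaussianReal (μ := 0) (v := v) (k : NNReal))
  have h2 := this.integrable_norm_pow'
  refine (integrable_norm_iff (by fun_prop)).1 ?_
  simpa using h2

theorem gH_hasDeriv (n : ℕ) (t x : ℝ) : HasDerivAt (fun x => gH (n+1) x t) (gH n x t) x := by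
  induction n using Nat.twoStepInduction with
  | zero => simp only [gH]; exact hasDerivAt_id x
  | one =>
    have h : HasDerivAt (fun x : ℝ => (x * x - t * 1) / ((0 : ℕ) + 2)) ((1 * x + x * 1) / ((0:ℕ) + 2)) x :=
      (((hasDerivAt_id x).mul (hasDerivAt_id x)).sub_const _).div_const _
    simp only [gH]
    convert h using 1
    simp
  | more n i0 i1 =>
    have h := ((((hasDerivAt_id x).mul i1).sub (i0.const_mul t)).div_const (((n+1 : ℕ) : ℝ) + 2))
    have e : (fun x => gH (n + 2 + 1) x t) = fun x => (x * gH (n+1+1) x t - t * gH (n+1) x t) / (((n+1 : ℕ) : ℝ) + 2) := by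
      funext x; rw [gH]
    rw [e]
    refine h.congr_deriv ?_
    have := gH_rec n x t
    rw [div_eq_iff (by positivity)]
    push_cast
    simp only [id]
    linarith

theorem gH_integral (n : ℕ) (u : NNReal) : ∫ x, gH (n+1) x u ∂(gaussianReal 0 u) = 0 := by
  by_cases hu : u = 0
  · subst hu
    simp only [gaussianReal_zero_var, integral_dirac, NNReal.coe_zero]
    induction n using Nat.twoStepInduction with
    | zero => simp [gH]
    | one => simp [gH]
    | more n _ _ => simp [gH]
  have hu' : (0:ℝ) < u := by positivity
  have hint : ∀ k, Integrable (fun x => gaussianPDFReal 0 u x * gH k x u) := by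
    intro k
    have := gH_int k u u
    rw [gaussianReal_of_var_ne_zero _ hu] at this
    rw [integrable_withDensity_iff_integrable_smul₀' (by fun_prop) (by simp [gaussianPDF])] at this
    simpa using this
  rw [integral_gaussianReal_eq_integral_smul hu]
  simp only [smul_eq_mul]
  have hpdf : ∀ x, HasDerivAt (gaussianPDFReal 0 u) (- (x / u) * gaussianPDFReal 0 u x) x := by
    intro x
    have h1 : HasDerivAt (fun x : ℝ => -(x - 0)^2 / (2 * u)) (-(2 * x) / (2 * u)) x := by
      have := (((hasDerivAt_id x).sub_const 0).pow 2).neg.div_const (2 * (u:ℝ))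
      exact this.congr_deriv (by simp)
    have h2 := (h1.exp).const_mul ((√(2 * Real.pi * u))⁻¹)
    rw [gaussianPDFReal_def]
    refine h2.congr_deriv ?_
    field_simp
  have hd : ∀ x, HasDerivAt (fun x => gaussianPDFReal 0 u x * gH n x u)
      (-((n + 1) / u) * (gaussianPDFReal 0 u x * gH (n+1) x u)) x := by
    intro x
    cases n with
    | zero =>
      have := (hpdf x).mul_const 1
      simp only [gH]
      refine this.congr_deriv ?_
      simp; ring
    | succ n =>
      refine ((hpdf x).mul (gH_hasDeriv n u x)).congr_deriv ?_
      have := gH_rec n x u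
      have e : gH n x u = (x * gH (n+1) x u - (n+2) * gH (n+2) x u) / u := by
        rw [this]; field_simp; ring
      rw [e]; push_cast; field_simp; ring
  have h0 := integral_eq_zero_of_hasDerivAt_of_integrable hd ((hint (n+1)).const_mul _) (hint n)
  rw [integral_const_mul] at h0
  rcases mul_eq_zero.1 h0 with h | h
  · exfalso
    have : (0:ℝ) < (n+1)/u := by positivity
    linarith
  · exact h

theorem natFilt_le {Ω : Type*} [m : MeasurableSpace Ω] {P : Measure Ω} {B : ℝ → Ω → ℝ}
    (hB : IsStdBM P B) (t : ℝ) : natFilt B t ≤ m :=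
  iSup₂_le fun s _ => (hB.meas s).comap_le

theorem natFilt_meas {Ω : Type*} (B : ℝ → Ω → ℝ) {t : ℝ} (ht : 0 ≤ t) :
    Measurable[natFilt B t] (B t) := by
  have : MeasurableSpace.comap (B t) inferInstance ≤ natFilt B t :=
    le_iSup₂_of_le (f := fun s (_ : s ∈ Set.Icc (0:ℝ) t) => MeasurableSpace.comap (B s) inferInstance)
      t ⟨ht, le_rfl⟩ le_rfl
  exact measurable_iff_comap_le.2 this

theorem bm_law {Ω : Type*} [MeasurableSpace Ω] {P : Measure Ω} {B : ℝ → Ω → ℝ}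
    (hB : IsStdBM P B) {t : ℝ} (ht : 0 ≤ t) : P.map (B t) = gaussianReal 0 (Real.toNNReal t) := by
  have := hB.gauss_incr 0 t le_rfl ht
  rw [sub_zero] at this
  rw [← this]
  refine Measure.map_congr ?_
  filter_upwards [hB.init] with ω h
  simp [h]

theorem law_int {Ω : Type*} [MeasurableSpace Ω] {P : Measure Ω} {Z : Ω → ℝ} (hZ : Measurable Z)
    {v : NNReal} (h : P.map Z = gaussianReal 0 v) (n : ℕ) (t : ℝ) :
    Integrable (fun ω => gH n (Z ω) t) P := by
  have := gH_int n t v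
  rw [← h] at this
  exact this.comp_measurable hZ

theorem gH_mart {Ω : Type*} [MeasurableSpace Ω]
    (P : Measure Ω) (B : ℝ → Ω → ℝ) (hB : IsStdBM P B) (n : ℕ) (s t : ℝ) (hs : 0 ≤ s) (hst : s ≤ t) :
    P[fun ω => gH n (B t ω) t | natFilt B s] =ᵐ[P] fun ω => gH n (B s ω) s := by
  haveI := hB.isProb
  have hle := natFilt_le hB s
  have hD : Measurable fun ω => B t ω - B s ω := (hB.meas t).sub (hB.meas s)
  have hind := hB.indep_incr s t hs hst
  have hlaw := hB.gauss_incr s t hs hst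
  have hBs := natFilt_meas B hs
  have hut : ((Real.toNNReal (t - s) : NNReal) : ℝ) = t - s := Real.coe_toNNReal _ (by linarith)
  set X : ℕ × ℕ → Ω → ℝ := fun p ω => gH p.1 (B s ω) s * gH p.2 (B t ω - B s ω) (t - s) with hX
  have hsum : (fun ω => gH n (B t ω) t) = ∑ p ∈ Finset.HasAntidiagonal.antidiagonal n, X p := by
    funext ω
    have := gH_add n (B s ω) (B t ω - B s ω) s (t - s)
    simp only [add_sub_cancel] at this
    rw [this]; simp [hX]
  have hi1 : ∀ k, Integrable (fun ω => gH k (B s ω) s) P := fun k =>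
    law_int (hB.meas s) (bm_law hB hs) k s
  have hi2 : ∀ k, Integrable (fun ω => gH k (B t ω - B s ω) (t - s)) P := fun k =>
    law_int hD hlaw k _
  have hm1 : ∀ k, Measurable[natFilt B s] (fun ω => gH k (B s ω) s) := fun k =>
    (gH_cont k s).measurable.comp hBs
  have hm2 : ∀ k, Measurable[MeasurableSpace.comap (fun ω => B t ω - B s ω) inferInstance]
      (fun ω => gH k (B t ω - B s ω) (t - s)) := fun k =>
    (gH_cont k _).measurable.comp (comap_measurable _)
  have hiX : ∀ p, Integrable (X p) P := by
    intro p
    have hif : IndepFun (fun ω => gH p.2 (B t ω - B s ω) (t - s)) (fun ω => gH p.1 (B s ω) s) P := by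
      rw [IndepFun_iff_Indep]
      exact indep_of_indep_of_le_left (indep_of_indep_of_le_right hind (hm1 p.1).comap_le)
        (hm2 p.2).comap_le
    exact hif.symm.integrable_mul (hi1 _) (hi2 _)
  have hcX : ∀ p, P[X p | natFilt B s] =ᵐ[P]
      fun ω => gH p.1 (B s ω) s * ∫ ω, gH p.2 (B t ω - B s ω) (t - s) ∂P := by
    intro p
    have h1 := condExp_mul_of_stronglyMeasurable_left (μ := P) (hm1 p.1).stronglyMeasurable
      (hiX p) (hi2 p.2)
    have h2 := condExp_indep_eq hD.comap_le hle (hm2 p.2).stronglyMeasurable hind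
    refine h1.trans ?_
    filter_upwards [h2] with ω h
    simp [h]
  have hE : ∀ k, ∫ ω, gH (k+1) (B t ω - B s ω) (t - s) ∂P = 0 := by
    intro k
    have := gH_integral k (Real.toNNReal (t - s))
    rw [← hlaw, hut, integral_map hD.aemeasurable (gH_cont _ _).aestronglyMeasurable] at this
    exact this
  rw [hsum]
  refine (condExp_finsetSum (fun p _ => hiX p) _).trans ?_
  have hall : ∀ᵐ ω ∂P, ∀ p, P[X p | natFilt B s] ω =
      gH p.1 (B s ω) s * ∫ ω, gH p.2 (B t ω - B s ω) (t - s) ∂P := ae_all_iff.2 hcX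
  filter_upwards [hall] with ω h
  simp only [Finset.sum_apply, h]
  rw [Finset.sum_eq_single (n, 0)]
  · simp [gH]
  · rintro ⟨i, j⟩ hij hne
    cases j with
    | zero => simp at hij; simp [hij] at hne
    | succ j => simp [hE]
  · simp

/-- For a standard Brownian motion `B`, each process `t ↦ H_n(B_t, t)` built from the
probabilists' Hermite polynomials is a martingale with respect to the natural filtration. -/
theorem hermite_spaceTime_martingale {Ω : Type*} [MeasurableSpace Ω]
    (P : Measure Ω) (B : ℝ → Ω → ℝ) (hB : IsStdBM P B) (n : ℕ) :
    IsMartingaleFrom0 P (natFilt B) (fun t ω => hermiteSpaceTime n (B t ω) t) := by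
  have e : ∀ t, 0 ≤ t → (fun ω => hermiteSpaceTime n (B t ω) t) =
      fun ω => (n.factorial : ℝ) * gH n (B t ω) t := fun t ht => by
    funext ω; exact hst_eq n _ t ht
  refine ⟨fun t ht => ?_, fun t ht => ?_, fun s t hs hst => ?_⟩
  · simp only [e t ht]
    exact (law_int (hB.meas t) (bm_law hB ht) n t).const_mul _
  · simp only [e t ht]
    exact ((gH_cont n t).measurable.comp (natFilt_meas B ht)).const_mul _
  · simp only [e t (hs.trans hst), e s hs]
    have h1 := condExp_smul (μ := P) (n.factorial : ℝ) (fun ω => gH n (B t ω) t) (natFilt B s)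
    refine h1.trans ?_
    filter_upwards [gH_mart P B hB n s t hs hst] with ω h
    simp [h]
end
end
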